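/- Let X be an infinite-dimensional real Banach space and J : X → ℝ a C¹ functional such that: (J1) J is even (J(-u) = J(u) for all u ∈ X), J is bounded from below, J(0) = 0, and J satisfies the Palais–Smale condition; (J2) for every k ∈ ℕ there exist a k-dimensional linear subspace X_k of X and a number r_k > 0 such that sup { J(u) : u ∈ X_k, ‖u‖ = r_k } < 0. Then J admits a sequence of critical points {v_k} (i.e., the Fréchet derivative J'(v_k) = 0 for every k) with v_k ≠ 0, J(v_k) ≤ 0 for all k, and ‖v_k‖ → 0 as k → ∞. -/

import Mathlib

open Finset in
theorem Finset.card_zmod_two_eq_zero_of_involution {α : Type*} (s : Finset α) (g : α → α)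
    (hmem : ∀ x ∈ s, g x ∈ s) (hinv : ∀ x ∈ s, g (g x) = x) (hne : ∀ x ∈ s, g x ≠ x) :
    (s.card : ZMod 2) = 0 := by
  have := Finset.sum_involution (s := s) (f := fun _ => (1 : ZMod 2)) (fun x _ => g x)
    (fun _ _ => by decide) (fun x hx _ => hne x hx) (fun x hx => hmem x hx)
    (fun x hx => hinv x hx)
  simpa using this

namespace SignedLattice

variable {n k : ℕ}

/-- The signed unit vector attached to a signed coordinate. -/
def step (p : Fin n × ℤˣ) : Fin n → ℤ := Pi.single p.1 (p.2 : ℤ)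

/-- The opposite signed coordinate. -/
def opp (p : Fin n × ℤˣ) : Fin n × ℤˣ := (p.1, -p.2)

theorem opp_opp (p : Fin n × ℤˣ) : opp (opp p) = p := by simp [opp]

theorem opp_ne (p : Fin n × ℤˣ) : opp p ≠ p := by
  intro h
  have := congrArg (fun q => ((q.2 : ℤˣ) : ℤ)) h
  rcases Int.units_eq_one_or p.2 with h' | h' <;> simp [opp, h'] at this

theorem eq_or_eq_opp {p q : Fin n × ℤˣ} (h : p.1 = q.1) : p = q ∨ p = opp q := by
  rcases Int.units_eq_one_or p.2 with h' | h' <;> rcases Int.units_eq_one_or q.2 with h'' | h'' <;>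
    simp [Prod.ext_iff, opp, h, h', h'']

/-- The `j`-th vertex of the path of unit steps `m` started at `u`. -/
def vertex (m : Fin k → Fin n × ℤˣ) (u : Fin n → ℤ) (j : ℕ) : Fin n → ℤ :=
  u + ∑ i : Fin k, if (i : ℕ) < j then step (m i) else 0

theorem vertex_cons_succ (a : Fin n × ℤˣ) (m : Fin k → Fin n × ℤˣ) (u : Fin n → ℤ) (j : ℕ) :
    vertex (Fin.cons a m : Fin (k + 1) → Fin n × ℤˣ) u (j + 1) = vertex m (u + step a) j := by
  simp [vertex, Fin.sum_univ_succ, add_assoc]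

theorem vertex_snoc (a : Fin n × ℤˣ) (m : Fin k → Fin n × ℤˣ) (u : Fin n → ℤ) {j : ℕ}
    (hj : j ≤ k) :
    vertex (Fin.snoc m a : Fin (k + 1) → Fin n × ℤˣ) u j = vertex m u j := by
  simp [vertex, Fin.sum_univ_castSucc, not_lt.2 hj]

theorem vertex_opp (m : Fin k → Fin n × ℤˣ) (u : Fin n → ℤ) (j : ℕ) :
    vertex (fun i => opp (m i)) (-u) j = -vertex m u j := by
  simp only [vertex, neg_add, ← Finset.sum_neg_distrib]
  congr 1
  refine Finset.sum_congr rfl fun i _ => ?_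
  split_ifs <;> simp [step, opp, Pi.single_neg]

theorem vertex_comp_perm (m : Fin k → Fin n × ℤˣ) (u : Fin n → ℤ) (j : ℕ)
    (σ : Equiv.Perm (Fin k)) (hσ : ∀ i, ((σ i : Fin k) : ℕ) < j ↔ (i : ℕ) < j) :
    vertex (m ∘ σ) u j = vertex m u j := by
  simp only [vertex]
  congr 1
  rw [← Equiv.sum_comp σ (fun i => if (i : ℕ) < j then step (m i) else 0)]
  simp [hσ]

theorem vertex_apply (m : Fin k → Fin n × ℤˣ) (u : Fin n → ℤ) (j : ℕ)
    (hm : Function.Injective fun i => (m i).1) (i : Fin k) :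
    vertex m u j (m i).1 = u (m i).1 + if (i : ℕ) < j then ((m i).2 : ℤ) else 0 := by
  simp only [vertex, Pi.add_apply, Finset.sum_apply]
  congr 1
  rw [Finset.sum_eq_single i]
  · split_ifs <;> simp [step]
  · intro b _ hb
    have : (m i).1 ≠ (m b).1 := fun h => hb (hm h).symm
    split_ifs <;> simp [step, this]
  · simp

theorem vertex_apply_of_forall_ne (m : Fin k → Fin n × ℤˣ) (u : Fin n → ℤ) (j : ℕ) {c : Fin n}
    (hc : ∀ i, (m i).1 ≠ c) : vertex m u j c = u c := by
  simp only [vertex, Pi.add_apply, Finset.sum_apply, add_eq_left]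
  refine Finset.sum_eq_zero fun i _ => ?_
  have := (hc i).symm
  split_ifs <;> simp [step, this]

/-- The simplex with base point `u` and directions `m` lies in the orthant spanned by `m`,
inside the cube of radius `N`. -/
def IsFlag (N : ℕ) (m : Fin k → Fin n × ℤˣ) (u : Fin n → ℤ) : Prop :=
  (Function.Injective fun i => (m i).1) ∧
  (∀ i, 0 ≤ ((m i).2 : ℤ) * u (m i).1 ∧ ((m i).2 : ℤ) * u (m i).1 < N) ∧
  ∀ c, (∀ i, (m i).1 ≠ c) → u c = 0

/-- The simplex with base point `u` and directions `m` lies in the orthant spanned by `m` and `a`,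
inside the cube of radius `N`, in a layer orthogonal to `a`. -/
def IsWall (N : ℕ) (a : Fin n × ℤˣ) (m : Fin k → Fin n × ℤˣ) (u : Fin n → ℤ) : Prop :=
  (Function.Injective fun i => (m i).1) ∧ (∀ i, (m i).1 ≠ a.1) ∧
  (∀ i, 0 ≤ ((m i).2 : ℤ) * u (m i).1 ∧ ((m i).2 : ℤ) * u (m i).1 < N) ∧
  (0 ≤ (a.2 : ℤ) * u a.1 ∧ (a.2 : ℤ) * u a.1 ≤ N) ∧
  ∀ c, (∀ i, (m i).1 ≠ c) → a.1 ≠ c → u c = 0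

theorem abs_le_of_unit_mul {s : ℤˣ} {x : ℤ} {N : ℕ} (h0 : 0 ≤ (s : ℤ) * x) (h1 : (s : ℤ) * x ≤ N) :
    |x| ≤ N := by
  rcases Int.units_eq_one_or s with h | h <;> simp [h] at h0 h1 <;> rw [abs_le] <;>
    constructor <;> linarith

theorem IsWall.abs_le {N : ℕ} {a : Fin n × ℤˣ} {m : Fin k → Fin n × ℤˣ} {u : Fin n → ℤ}
    (h : IsWall N a m u) (c : Fin n) : |u c| ≤ N := by
  obtain ⟨-, -, h3, h4, h5⟩ := h
  by_cases hc : ∃ i, (m i).1 = c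
  · obtain ⟨i, rfl⟩ := hc
    exact abs_le_of_unit_mul (h3 i).1 (h3 i).2.le
  · by_cases hac : a.1 = c
    · subst hac
      exact abs_le_of_unit_mul h4.1 h4.2
    · rw [h5 c (by simpa using hc) hac]; simp

theorem IsFlag.vertex_abs_le {N : ℕ} {m : Fin k → Fin n × ℤˣ} {u : Fin n → ℤ}
    (h : IsFlag N m u) (j : ℕ) (c : Fin n) : |vertex m u j c| ≤ N := by
  obtain ⟨h1, h2, h3⟩ := h
  by_cases hc : ∃ i, (m i).1 = c
  · obtain ⟨i, rfl⟩ := hc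
    rw [vertex_apply m u j h1 i]
    have := h2 i
    have hu : (((m i).2 : ℤˣ) : ℤ) * ((m i).2 : ℤ) = 1 := by
      rcases Int.units_eq_one_or (m i).2 with h | h <;> simp [h]
    refine abs_le_of_unit_mul (s := (m i).2) ?_ ?_ <;> rw [mul_add] <;> split_ifs <;>
      simp only [hu, mul_zero] <;> omega
  · rw [vertex_apply_of_forall_ne m u j (by simpa using hc), h3 c (by simpa using hc)]; simp

theorem IsFlag.abs_le {N : ℕ} {m : Fin k → Fin n × ℤˣ} {u : Fin n → ℤ}
    (h : IsFlag N m u) (c : Fin n) : |u c| ≤ N := by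
  simpa [vertex] using h.vertex_abs_le 0 c

theorem IsFlag.vertex_sub_abs_le {N : ℕ} {m : Fin k → Fin n × ℤˣ} {u : Fin n → ℤ}
    (h : IsFlag N m u) (j j' : ℕ) (c : Fin n) : |vertex m u j c - vertex m u j' c| ≤ 1 := by
  by_cases hc : ∃ i, (m i).1 = c
  · obtain ⟨i, rfl⟩ := hc
    rw [vertex_apply m u j h.1 i, vertex_apply m u j' h.1 i]
    rcases Int.units_eq_one_or (m i).2 with h | h <;> rw [h] <;> split_ifs <;> simp
  · simp [vertex_apply_of_forall_ne m u _ (c := c) (by simpa using hc)]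

theorem isFlag_snoc {N : ℕ} {a : Fin n × ℤˣ} {m : Fin k → Fin n × ℤˣ} {u : Fin n → ℤ} :
    IsFlag N (Fin.snoc m a : Fin (k + 1) → Fin n × ℤˣ) u ↔
      IsWall N a m u ∧ (a.2 : ℤ) * u a.1 < N := by
  have hinj : (Function.Injective fun i => ((Fin.snoc m a : Fin (k + 1) → Fin n × ℤˣ) i).1) ↔
      (Function.Injective fun i => (m i).1) ∧ ∀ i, (m i).1 ≠ a.1 := by
    have : (fun i => ((Fin.snoc m a : Fin (k + 1) → Fin n × ℤˣ) i).1) =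
        Fin.snoc (fun i => (m i).1) a.1 := by
      ext i; refine Fin.lastCases ?_ (fun i => ?_) i <;> simp
    rw [this, Fin.snoc_injective_iff]; simp
  simp only [IsFlag, IsWall, hinj, Fin.forall_fin_succ', Fin.snoc_castSucc, Fin.snoc_last]
  constructor
  · rintro ⟨⟨h1, h2⟩, ⟨h3, h4⟩, h5⟩
    exact ⟨⟨h1, h2, h3, ⟨h4.1, h4.2.le⟩, fun c hc hac => h5 c ⟨hc, hac⟩⟩, h4.2⟩
  · rintro ⟨⟨h1, h2, h3, h4, h5⟩, h6⟩
    exact ⟨⟨h1, h2⟩, ⟨h3, h4.1, h6⟩, fun c hc => h5 c hc.1 hc.2⟩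

theorem isFlag_cons {N : ℕ} {a : Fin n × ℤˣ} {m : Fin k → Fin n × ℤˣ} {u : Fin n → ℤ} :
    IsFlag N (Fin.cons a m : Fin (k + 1) → Fin n × ℤˣ) u ↔
      IsWall N a m u ∧ (a.2 : ℤ) * u a.1 < N := by
  have hinj : (Function.Injective fun i => ((Fin.cons a m : Fin (k + 1) → Fin n × ℤˣ) i).1) ↔
      (Function.Injective fun i => (m i).1) ∧ ∀ i, (m i).1 ≠ a.1 := by
    have : (fun i => ((Fin.cons a m : Fin (k + 1) → Fin n × ℤˣ) i).1) =
        Fin.cons a.1 (fun i => (m i).1) := by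
      ext i; refine Fin.cases ?_ (fun i => ?_) i <;> simp
    rw [this, Fin.cons_injective_iff]; simp [and_comm]
  simp only [IsFlag, IsWall, hinj, Fin.forall_fin_succ, Fin.cons_succ, Fin.cons_zero]
  constructor
  · rintro ⟨⟨h1, h2⟩, ⟨h4, h3⟩, h5⟩
    exact ⟨⟨h1, h2, h3, ⟨h4.1, h4.2.le⟩, fun c hc hac => h5 c ⟨hac, hc⟩⟩, h4.2⟩
  · rintro ⟨⟨h1, h2, h3, h4, h5⟩, h6⟩
    exact ⟨⟨h1, h2⟩, ⟨⟨h4.1, h6⟩, h3⟩, fun c hc => h5 c hc.2 hc.1⟩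

theorem isWall_add_step {N : ℕ} {a : Fin n × ℤˣ} {m : Fin k → Fin n × ℤˣ} {u : Fin n → ℤ} :
    (IsWall N a m u ∧ (a.2 : ℤ) * u a.1 < N) ↔
      (IsWall N a m (u + step a) ∧ (a.2 : ℤ) * (u + step a) a.1 ≠ 0) := by
  have hu : ((a.2 : ℤˣ) : ℤ) * (a.2 : ℤ) = 1 := by
    rcases Int.units_eq_one_or a.2 with h | h <;> simp [h]
  have ha : (a.2 : ℤ) * (u + step a) a.1 = (a.2 : ℤ) * u a.1 + 1 := by
    simp [step, mul_add, hu]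
  have hne : ∀ c, a.1 ≠ c → (u + step a) c = u c := fun c hc => by simp [step, hc.symm]
  unfold IsWall
  rw [ha]
  constructor
  · rintro ⟨⟨h1, h2, h3, h4, h5⟩, h6⟩
    refine ⟨⟨h1, h2, fun i => ?_, by omega, fun c hc hac => ?_⟩, by omega⟩
    · rw [hne _ (h2 i).symm]; exact h3 i
    · rw [hne _ hac]; exact h5 c hc hac
  · rintro ⟨⟨h1, h2, h3, h4, h5⟩, h6⟩
    refine ⟨⟨h1, h2, fun i => ?_, by omega, fun c hc hac => ?_⟩, by omega⟩
    · rw [← hne _ (h2 i).symm]; exact h3 i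
    · rw [← hne _ hac]; exact h5 c hc hac

open Finset in
theorem card_faces_eq {α : Type*} [DecidableEq α] (f : Fin (k + 2) → α) (L : Finset α)
    (hL : L.card = k + 1) :
    ((univ.filter fun j => (univ.erase j).image f = L).card : ZMod 2) =
      if L ⊆ univ.image f ∧ Function.Injective f then 1 else 0 := by
  by_cases hf : Function.Injective f
  · by_cases hsub : L ⊆ univ.image f
    · rw [if_pos ⟨hsub, hf⟩]
      have hc : (univ.image f \ L).card = 1 := by
        rw [card_sdiff_of_subset hsub, card_image_of_injective _ hf, hL]; simp
      obtain ⟨y, hy⟩ := card_eq_one.1 hc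
      have hy' : y ∈ univ.image f \ L := by simp [hy]
      obtain ⟨j₀, -, rfl⟩ := mem_image.1 (mem_sdiff.1 hy').1
      have hLe : L = (univ.image f).erase (f j₀) := by
        rw [← sdiff_singleton_eq_erase, ← hy, Finset.sdiff_sdiff_eq_self hsub]
      have : (univ.filter fun j => (univ.erase j).image f = L) = {j₀} := by
        ext j
        simp only [mem_filter, mem_univ, true_and, mem_singleton, image_erase hf, hLe]
        constructor
        · intro h
          by_contra hne
          have : f j ∈ (univ.image f).erase (f j) := by
            rw [h]; simp [hf.eq_iff, hne]
          simp at this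
        · rintro rfl; rfl
      simp [this]
    · rw [if_neg (fun h => hsub h.1)]
      have : (univ.filter fun j => (univ.erase j).image f = L) = ∅ := by
        refine filter_eq_empty_iff.2 fun j _ h => hsub ?_
        rw [← h]; exact image_subset_image (erase_subset _ _)
      simp [this]
  · rw [if_neg (fun h => hf h.2)]
    obtain ⟨i, j, hij, hne⟩ : ∃ i j, f i = f j ∧ i ≠ j := by
      simpa [Function.Injective] using hf
    have himg : ∀ i j, f i = f j → i ≠ j → (univ.erase i).image f = univ.image f := by
      intro i j hij hne
      refine subset_antisymm (image_subset_image (erase_subset _ _)) fun y hy => ?_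
      obtain ⟨l, -, rfl⟩ := mem_image.1 hy
      by_cases hl : l = i
      · subst hl; exact mem_image.2 ⟨j, by simp [hne.symm], hij.symm⟩
      · exact mem_image_of_mem _ (by simp [hl])
    have hi := himg i j hij hne
    have hj := himg j i hij.symm hne.symm
    have hmem : ∀ l, (univ.erase l).image f = L → l = i ∨ l = j := by
      intro l hl
      by_contra hcon
      push Not at hcon
      have hinj : Set.InjOn f (univ.erase l : Finset _) := by
        rw [← card_image_iff, hl, hL]; simp
      exact hne (hinj (by simp [hcon.1.symm]) (by simp [hcon.2.symm]) hij)
    by_cases hL' : univ.image f = L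
    · have : (univ.filter fun j => (univ.erase j).image f = L) = {i, j} := by
        ext l
        simp only [mem_filter, mem_univ, true_and, mem_insert, mem_singleton]
        refine ⟨hmem l, ?_⟩
        rintro (rfl | rfl)
        · rw [hi, hL']
        · rw [hj, hL']
      rw [this, card_pair hne]; decide
    · have : (univ.filter fun j => (univ.erase j).image f = L) = ∅ := by
        refine filter_eq_empty_iff.2 fun l _ hl => hL' ?_
        rcases hmem l hl with rfl | rfl
        · rw [← hi, hl]
        · rw [← hj, hl]
      simp [this]

/-- The lattice points of the cube of radius `N`. -/
noncomputable def cube (n N : ℕ) : Finset (Fin n → ℤ) :=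
  Finset.Icc (fun _ => -(N : ℤ)) fun _ => (N : ℤ)

theorem mem_cube {N : ℕ} {u : Fin n → ℤ} : u ∈ cube n N ↔ ∀ c, |u c| ≤ N := by
  simp [cube, Pi.le_def, abs_le, forall_and]

/-- The simplex has pairwise distinct labels, which include all of its directions. -/
def IsFull (N : ℕ) (lab : (Fin n → ℤ) → Fin n × ℤˣ) (m : Fin k → Fin n × ℤˣ) (u : Fin n → ℤ) :
    Prop :=
  IsFlag N m u ∧
    Finset.univ.image m ⊆ Finset.univ.image (fun i : Fin (k + 1) => lab (vertex m u i)) ∧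
    Function.Injective fun i : Fin (k + 1) => lab (vertex m u i)

open Classical in
/-- The full simplices of dimension `k`. -/
noncomputable def fullSimplices (N k : ℕ) (lab : (Fin n → ℤ) → Fin n × ℤˣ) :
    Finset ((Fin k → Fin n × ℤˣ) × (Fin n → ℤ)) :=
  (Finset.univ ×ˢ cube n N).filter fun p => IsFull N lab p.1 p.2

open Classical in
/-- The simplices whose face opposite to the vertex `j` is labelled by its directions. -/
noncomputable def labelledFaces (N : ℕ) (lab : (Fin n → ℤ) → Fin n × ℤˣ) (j : Fin (k + 2)) :
    Finset ((Fin (k + 1) → Fin n × ℤˣ) × (Fin n → ℤ)) :=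
  (Finset.univ ×ˢ cube n N).filter fun p => IsFlag N p.1 p.2 ∧
    (Finset.univ.erase j).image (fun i : Fin (k + 2) => lab (vertex p.1 p.2 i)) =
      Finset.univ.image p.1

open Classical in
/-- The labelled walls satisfying an additional condition on the height. -/
noncomputable def labelledWalls (N k : ℕ) (lab : (Fin n → ℤ) → Fin n × ℤˣ) (P : ℤ → Prop) :
    Finset ((Fin n × ℤˣ) × (Fin k → Fin n × ℤˣ) × (Fin n → ℤ)) :=
  (Finset.univ ×ˢ Finset.univ ×ˢ cube n N).filter fun p =>
    (IsWall N p.1 p.2.1 p.2.2 ∧ P ((p.1.2 : ℤ) * p.2.2 p.1.1)) ∧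
    Finset.univ.image (fun i : Fin (k + 1) => lab (vertex p.2.1 p.2.2 i)) =
      insert p.1 (Finset.univ.image p.2.1)

variable {N : ℕ} {lab : (Fin n → ℤ) → Fin n × ℤˣ}

theorem mem_fullSimplices {p : (Fin k → Fin n × ℤˣ) × (Fin n → ℤ)} :
    p ∈ fullSimplices N k lab ↔ IsFull N lab p.1 p.2 := by
  simp only [fullSimplices, Finset.mem_filter, Finset.mem_product, Finset.mem_univ, true_and,
    mem_cube, and_iff_right_iff_imp]
  exact fun h => h.1.abs_le

theorem mem_labelledFaces {j : Fin (k + 2)} {p : (Fin (k + 1) → Fin n × ℤˣ) × (Fin n → ℤ)} :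
    p ∈ labelledFaces N lab j ↔ IsFlag N p.1 p.2 ∧
      (Finset.univ.erase j).image (fun i : Fin (k + 2) => lab (vertex p.1 p.2 i)) =
        Finset.univ.image p.1 := by
  simp only [labelledFaces, Finset.mem_filter, Finset.mem_product, Finset.mem_univ, true_and,
    mem_cube, and_iff_right_iff_imp]
  exact fun h => h.1.abs_le

theorem mem_labelledWalls {P : ℤ → Prop}
    {p : (Fin n × ℤˣ) × (Fin k → Fin n × ℤˣ) × (Fin n → ℤ)} :
    p ∈ labelledWalls N k lab P ↔
      (IsWall N p.1 p.2.1 p.2.2 ∧ P ((p.1.2 : ℤ) * p.2.2 p.1.1)) ∧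
      Finset.univ.image (fun i : Fin (k + 1) => lab (vertex p.2.1 p.2.2 i)) =
        insert p.1 (Finset.univ.image p.2.1) := by
  simp only [labelledWalls, Finset.mem_filter, Finset.mem_product, Finset.mem_univ, true_and,
    mem_cube, and_iff_right_iff_imp]
  exact fun h => h.1.1.abs_le

open Finset in
theorem card_fullSimplices_succ_eq_sum :
    ((fullSimplices N (k + 1) lab).card : ZMod 2) =
      ∑ j, ((labelledFaces (k := k) N lab j).card : ZMod 2) := by
  classical
  simp only [fullSimplices, labelledFaces, card_filter, Nat.cast_sum]
  rw [sum_comm]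
  refine sum_congr rfl fun p _ => ?_
  by_cases hp : IsFlag N p.1 p.2
  · have hL : (univ.image p.1).card = k + 1 := by
      rw [card_image_of_injective _ (Function.Injective.of_comp (f := Prod.fst) hp.1)]; simp
    have := card_faces_eq (fun i : Fin (k + 2) => lab (vertex p.1 p.2 i)) _ hL
    simp only [card_filter, Nat.cast_sum] at this
    simp only [IsFull, hp, true_and, Nat.cast_ite, Nat.cast_one, Nat.cast_zero] at this ⊢
    exact this.symm
  · simp [IsFull, hp]

open Finset in
theorem card_labelledFaces_of_interior (j : Fin (k + 2)) (h0 : j ≠ 0) (hl : j ≠ Fin.last (k + 1)) :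
    ((labelledFaces (k := k) N lab j).card : ZMod 2) = 0 := by
  obtain ⟨i, rfl⟩ := Fin.exists_succ_eq.2 h0
  have hik : (i : ℕ) < k := by
    have h1 := i.is_lt
    have h2 : (i : ℕ) ≠ k := fun h => hl (by ext; simp [h])
    omega
  set σ : Equiv.Perm (Fin (k + 1)) := Equiv.swap i ⟨i + 1, by omega⟩ with hσ
  have hv : ∀ (m : Fin (k + 1) → Fin n × ℤˣ) (u : Fin n → ℤ) (l : ℕ), l ≠ i + 1 →
      vertex (m ∘ σ) u l = vertex m u l := by
    intro m u l hl
    refine vertex_comp_perm m u l σ fun a => ?_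
    rw [hσ, Equiv.swap_apply_def]
    split_ifs with h1 h2
    · subst h1; simp only; omega
    · subst h2; simp only; omega
    · rfl
  refine card_zmod_two_eq_zero_of_involution _ (fun p => (p.1 ∘ σ, p.2)) ?_ ?_ ?_
  · intro p hp
    rw [mem_labelledFaces] at hp ⊢
    obtain ⟨⟨h1, h2, h3⟩, h4⟩ := hp
    refine ⟨⟨h1.comp σ.injective, fun i => h2 (σ i), fun c hc => h3 c fun i => ?_⟩, ?_⟩
    · simpa using hc (σ.symm i)
    · have : univ.image (p.1 ∘ σ) = univ.image p.1 := by
        ext y; simp only [mem_image, mem_univ, true_and, Function.comp]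
        exact σ.surjective.exists (p := fun a => p.1 a = y) |>.symm
      rw [this, ← h4]
      refine image_congr fun l hl => ?_
      have hl' : l ≠ i.succ := by simpa using hl
      simp only
      rw [hv _ _ _ (fun h => hl' (by ext; simpa using h))]
  · intro p _
    ext1
    · ext1 l; simp [hσ]
    · rfl
  · intro p hp h
    have hinj := (mem_labelledFaces.1 hp).1.1
    have := congrFun (congrArg Prod.fst h) i
    simp only [Function.comp, hσ, Equiv.swap_apply_left] at this
    have := hinj (congrArg Prod.fst this)
    simp [Fin.ext_iff] at this

open Finset in
theorem card_labelledFaces_zero :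
    (labelledFaces (k := k) N lab 0).card = (labelledWalls N k lab (· ≠ 0)).card := by
  have key : ∀ (a : Fin n × ℤˣ) (m : Fin k → Fin n × ℤˣ) (u : Fin n → ℤ),
      ((univ.erase 0).image (fun i : Fin (k + 2) =>
        lab (vertex (Fin.cons a m : Fin (k + 1) → Fin n × ℤˣ) u i)) =
        univ.image (Fin.cons a m : Fin (k + 1) → Fin n × ℤˣ)) ↔
      univ.image (fun i : Fin (k + 1) => lab (vertex m (u + step a) i)) =
        insert a (univ.image m) := by
    intro a m u
    have h1 : (univ.erase 0) = univ.image (Fin.succ : Fin (k + 1) → _) := by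
      ext i; refine Fin.cases ?_ (fun i => ?_) i <;> simp
    have h2 : univ.image (Fin.cons a m : Fin (k + 1) → Fin n × ℤˣ) =
        insert a (univ.image m) := by
      ext y; simp [Fin.exists_fin_succ, eq_comm]
    rw [h1, h2, image_image]
    have h3 : ((fun i : Fin (k + 2) =>
        lab (vertex (Fin.cons a m : Fin (k + 1) → Fin n × ℤˣ) u i)) ∘ Fin.succ) =
        fun i : Fin (k + 1) => lab (vertex m (u + step a) i) := by
      ext1 i
      simp only [Function.comp, Fin.val_succ]
      rw [vertex_cons_succ]
    rw [h3]
  refine card_bij' (fun p _ => (p.1 0, Fin.tail p.1, p.2 + step (p.1 0)))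
    (fun q _ => (Fin.cons q.1 q.2.1, q.2.2 - step q.1)) ?_ ?_ ?_ ?_
  · rintro ⟨m, u⟩ hp
    rw [mem_labelledFaces] at hp
    obtain ⟨h1, h2⟩ := hp
    rw [mem_labelledWalls]
    obtain ⟨a, m, rfl⟩ : ∃ a m', m = (Fin.cons a m' : Fin (k + 1) → Fin n × ℤˣ) :=
      ⟨_, _, (Fin.cons_self_tail m).symm⟩
    simp only [Fin.cons_zero, Fin.tail_cons]
    exact ⟨isWall_add_step.1 (isFlag_cons.1 h1), (key a m u).1 h2⟩
  · rintro ⟨a, m, u⟩ hp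
    rw [mem_labelledWalls] at hp
    obtain ⟨h1, h2⟩ := hp
    rw [mem_labelledFaces]
    exact ⟨isFlag_cons.2 (isWall_add_step.2 (by simpa using h1)),
      (key a m _).2 (by simpa using h2)⟩
  · rintro ⟨m, u⟩ _; simp
  · rintro ⟨a, m, u⟩ _; simp

open Finset in
theorem card_labelledFaces_last :
    (labelledFaces (k := k) N lab (Fin.last (k + 1))).card =
      (labelledWalls N k lab (· < (N : ℤ))).card := by
  have key : ∀ (a : Fin n × ℤˣ) (m : Fin k → Fin n × ℤˣ) (u : Fin n → ℤ),
      ((univ.erase (Fin.last (k + 1))).image (fun i : Fin (k + 2) =>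
        lab (vertex (Fin.snoc m a : Fin (k + 1) → Fin n × ℤˣ) u i)) =
        univ.image (Fin.snoc m a : Fin (k + 1) → Fin n × ℤˣ)) ↔
      univ.image (fun i : Fin (k + 1) => lab (vertex m u i)) = insert a (univ.image m) := by
    intro a m u
    have h1 : (univ.erase (Fin.last (k + 1))) = univ.image (Fin.castSucc : Fin (k + 1) → _) := by
      ext i; refine Fin.lastCases ?_ (fun i => ?_) i <;> simp
    have h2 : univ.image (Fin.snoc m a : Fin (k + 1) → Fin n × ℤˣ) =
        insert a (univ.image m) := by
      ext y; simp [Fin.exists_fin_succ', eq_comm, or_comm]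
    rw [h1, h2, image_image]
    have h3 : ((fun i : Fin (k + 2) =>
        lab (vertex (Fin.snoc m a : Fin (k + 1) → Fin n × ℤˣ) u i)) ∘ Fin.castSucc) =
        fun i : Fin (k + 1) => lab (vertex m u i) := by
      ext1 i
      simp only [Function.comp, Fin.val_castSucc]
      rw [vertex_snoc _ _ _ (by omega)]
    rw [h3]
  refine card_bij' (fun p _ => (p.1 (Fin.last k), Fin.init p.1, p.2))
    (fun q _ => (Fin.snoc q.2.1 q.1, q.2.2)) ?_ ?_ ?_ ?_
  · rintro ⟨m, u⟩ hp
    rw [mem_labelledFaces] at hp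
    obtain ⟨h1, h2⟩ := hp
    rw [mem_labelledWalls]
    obtain ⟨a, m, rfl⟩ : ∃ a m', m = (Fin.snoc m' a : Fin (k + 1) → Fin n × ℤˣ) :=
      ⟨_, _, (Fin.snoc_init_self m).symm⟩
    simp only [Fin.snoc_last, Fin.init_snoc]
    exact ⟨isFlag_snoc.1 h1, (key a m u).1 h2⟩
  · rintro ⟨a, m, u⟩ hp
    rw [mem_labelledWalls] at hp
    rw [mem_labelledFaces]
    exact ⟨isFlag_snoc.2 hp.1, (key a m u).2 hp.2⟩
  · rintro ⟨m, u⟩ _; simp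
  · rintro ⟨a, m, u⟩ _; simp

open Finset in
theorem card_labelledWalls_add (P Q : ℤ → Prop)
    (h : ∀ x : ℤ, 0 ≤ x → x ≤ N → (Q x ↔ ¬P x)) :
    (labelledWalls N k lab P).card + (labelledWalls N k lab Q).card =
      (labelledWalls N k lab fun _ => True).card := by
  classical
  rw [← card_filter_add_card_filter_not (s := labelledWalls N k lab fun _ => True)
    (fun p => P ((p.1.2 : ℤ) * p.2.2 p.1.1))]
  congr 2
  · ext p
    simp only [mem_filter, mem_labelledWalls]
    tauto
  · ext p
    simp only [mem_filter, mem_labelledWalls]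
    constructor
    · rintro ⟨⟨h1, h2⟩, h3⟩
      exact ⟨⟨⟨h1, trivial⟩, h3⟩, (h _ h1.2.2.2.1.1 h1.2.2.2.1.2).1 h2⟩
    · rintro ⟨⟨⟨h1, -⟩, h3⟩, h2⟩
      exact ⟨⟨h1, (h _ h1.2.2.2.1.1 h1.2.2.2.1.2).2 h2⟩, h3⟩

theorem IsWall.opp {a : Fin n × ℤˣ} {m : Fin k → Fin n × ℤˣ} {u : Fin n → ℤ}
    (h : IsWall N a m u) : IsWall N (opp a) (fun i => SignedLattice.opp (m i)) (-u) := by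
  obtain ⟨h1, h2, h3, h4, h5⟩ := h
  refine ⟨h1, h2, ?_, ?_, ?_⟩
  · simpa [SignedLattice.opp] using h3
  · simpa [SignedLattice.opp] using h4
  · intro c hc hac
    simpa using h5 c hc hac

theorem IsWall.vertex_abs_le {a : Fin n × ℤˣ} {m : Fin k → Fin n × ℤˣ} {u : Fin n → ℤ}
    (h : IsWall N a m u) (h0 : (a.2 : ℤ) * u a.1 ≠ 0) (j : ℕ) (c : Fin n) :
    |vertex m u j c| ≤ N := by
  have hw : IsWall N a m (u - step a + step a) ∧ (a.2 : ℤ) * (u - step a + step a) a.1 ≠ 0 := by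
    rw [sub_add_cancel]; exact ⟨h, h0⟩
  have := isFlag_cons.2 (isWall_add_step.2 hw)
  simpa [vertex_cons_succ] using this.vertex_abs_le (j + 1) c

open Finset in
theorem card_labelledWalls_top (hN : 1 ≤ N)
    (hodd : ∀ v : Fin n → ℤ, (∀ c, |v c| ≤ N) → (∃ c, |v c| = N) → lab (-v) = opp (lab v)) :
    ((labelledWalls N k lab (· = (N : ℤ))).card : ZMod 2) = 0 := by
  refine card_zmod_two_eq_zero_of_involution _
    (fun p => (opp p.1, (fun i => opp (p.2.1 i)), -p.2.2)) ?_ ?_ ?_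
  · rintro ⟨a, m, u⟩ hp
    rw [mem_labelledWalls] at hp ⊢
    obtain ⟨⟨h1, h2⟩, h3⟩ := hp
    simp only at h1 h2 h3 ⊢
    refine ⟨⟨h1.opp, by simpa [opp] using h2⟩, ?_⟩
    have hl : ∀ j, lab (vertex (fun i => opp (m i)) (-u) j) = opp (lab (vertex m u j)) := by
      intro j
      rw [vertex_opp, hodd _ (h1.vertex_abs_le (by omega) j) ⟨a.1, ?_⟩]
      rw [vertex_apply_of_forall_ne m u j h1.2.1]
      rcases Int.units_eq_one_or a.2 with h | h <;> simp [h] at h2 <;> rw [abs_eq (by simp)] <;>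
        omega
    simp only [hl]
    have : univ.image (fun i : Fin (k + 1) => opp (lab (vertex m u i))) =
        (univ.image (fun i : Fin (k + 1) => lab (vertex m u i))).image opp := by
      rw [image_image]; rfl
    rw [this, h3, image_insert, image_image]
    rfl
  · rintro ⟨a, m, u⟩ _
    simp [opp_opp]
  · rintro ⟨a, m, u⟩ _ h
    exact opp_ne a (congrArg Prod.fst h)

open Finset in
theorem card_labelledWalls_bot
    (hcompl : ∀ v w : Fin n → ℤ, (∀ c, |v c| ≤ N) → (∀ c, |w c| ≤ N) →
      (∀ c, |v c - w c| ≤ 1) → lab v ≠ opp (lab w)) :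
    (labelledWalls N k lab (· = 0)).card = (fullSimplices N k lab).card := by
  have hnot : ∀ {a : Fin n × ℤˣ} {m : Fin k → Fin n × ℤˣ} {u : Fin n → ℤ},
      IsWall N a m u → a ∉ univ.image m := by
    intro a m u h ha
    obtain ⟨i, -, hi⟩ := mem_image.1 ha
    exact h.2.1 i (by rw [hi])
  have hcard : ∀ {m : Fin k → Fin n × ℤˣ}, (Function.Injective fun i => (m i).1) →
      (univ.image m).card = k := by
    intro m hm
    rw [card_image_of_injective _ (Function.Injective.of_comp (f := Prod.fst) hm)]; simp
  refine card_bij (fun p _ => p.2) ?_ ?_ ?_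
  · rintro ⟨a, m, u⟩ hp
    rw [mem_labelledWalls] at hp
    obtain ⟨⟨h1, h2⟩, h3⟩ := hp
    simp only at h1 h2 h3
    rw [mem_fullSimplices]
    refine ⟨⟨h1.1, h1.2.2.1, fun c hc => ?_⟩, ?_, ?_⟩
    · by_cases hac : a.1 = c
      · subst hac
        simpa using h2
      · exact h1.2.2.2.2 c hc hac
    · simp only [h3]
      exact subset_insert _ _
    · have : (univ.image fun i : Fin (k + 1) => lab (vertex m u i)).card =
          (univ : Finset (Fin (k + 1))).card := by
        rw [h3, card_insert_of_notMem (hnot h1), hcard h1.1]; simp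
      have := card_image_iff.1 this
      simpa [Set.injOn_univ] using this
  · rintro ⟨a, m, u⟩ hp ⟨a', m', u'⟩ hp' h
    rw [mem_labelledWalls] at hp hp'
    simp only at hp hp' h
    obtain ⟨rfl, rfl⟩ := Prod.ext_iff.1 h
    have hins := hp.2.symm.trans hp'.2
    have ha : a ∈ insert a' (univ.image m) := hins ▸ mem_insert_self _ _
    rcases mem_insert.1 ha with rfl | ha
    · rfl
    · exact absurd ha (hnot hp.1.1)
  · rintro ⟨m, u⟩ hp
    rw [mem_fullSimplices] at hp
    obtain ⟨hflag, hsub, hinj⟩ := hp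
    simp only at hflag hsub hinj
    have hc : (univ.image (fun i : Fin (k + 1) => lab (vertex m u i)) \ univ.image m).card = 1 := by
      rw [card_sdiff_of_subset hsub, card_image_of_injective _ hinj, hcard hflag.1]; simp
    obtain ⟨a, ha⟩ := card_eq_one.1 hc
    have ha' : a ∈ univ.image (fun i : Fin (k + 1) => lab (vertex m u i)) \ univ.image m := by
      simp [ha]
    have hne : ∀ i, (m i).1 ≠ a.1 := by
      intro i hi
      rcases eq_or_eq_opp hi with h | h
      · exact (mem_sdiff.1 ha').2 (h ▸ mem_image_of_mem m (mem_univ i))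
      · obtain ⟨j, -, hj⟩ := mem_image.1 (mem_sdiff.1 ha').1
        obtain ⟨j', -, hj'⟩ := mem_image.1 (hsub (mem_image_of_mem m (mem_univ i)))
        refine hcompl _ _ (hflag.vertex_abs_le j') (hflag.vertex_abs_le j)
          (hflag.vertex_sub_abs_le j' j) ?_
        rw [hj, hj', h]
    have hu : u a.1 = 0 := hflag.2.2 _ hne
    refine ⟨(a, m, u), ?_, rfl⟩
    rw [mem_labelledWalls]
    refine ⟨⟨⟨hflag.1, hne, hflag.2.1, by simp [hu], fun c hc _ => hflag.2.2 c hc⟩,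
      by simp [hu]⟩, ?_⟩
    simp only
    rw [insert_eq, ← ha, sdiff_union_of_subset hsub]

theorem card_fullSimplices_succ (hN : 1 ≤ N)
    (hodd : ∀ v : Fin n → ℤ, (∀ c, |v c| ≤ N) → (∃ c, |v c| = N) → lab (-v) = opp (lab v))
    (hcompl : ∀ v w : Fin n → ℤ, (∀ c, |v c| ≤ N) → (∀ c, |w c| ≤ N) →
      (∀ c, |v c - w c| ≤ 1) → lab v ≠ opp (lab w)) :
    ((fullSimplices N (k + 1) lab).card : ZMod 2) = (fullSimplices N k lab).card := by
  rw [card_fullSimplices_succ_eq_sum, Fin.sum_univ_succ, Fin.sum_univ_castSucc,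
    Finset.sum_eq_zero fun i _ => card_labelledFaces_of_interior _ (Fin.succ_ne_zero _) fun h => ?_,
    Fin.succ_last, card_labelledFaces_zero, card_labelledFaces_last, zero_add,
    ← card_labelledWalls_bot hcompl]
  · have h1 := card_labelledWalls_add (N := N) (k := k) (lab := lab) (· = 0) (· ≠ 0)
      fun x _ _ => Iff.rfl
    have h2 := card_labelledWalls_add (N := N) (k := k) (lab := lab) (· = (N : ℤ)) (· < (N : ℤ))
      fun x _ hx => ⟨fun h => h.ne, fun h => lt_of_le_of_ne hx h⟩
    have h3 := congrArg (Nat.cast : ℕ → ZMod 2) (h1.trans h2.symm)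
    push_cast at h3
    rw [card_labelledWalls_top hN hodd, zero_add] at h3
    rw [← h3, add_comm, add_assoc, CharTwo.add_self_eq_zero, add_zero]
  · have := congrArg Fin.val h
    have hi := i.is_lt
    simp at this
    omega

/-- **Tucker's lemma** on the cubical lattice: a labelling by signed coordinates which is
antipodal on the boundary of the cube has a complementary pair of adjacent points. -/
theorem exists_complementary (hN : 1 ≤ N) (lab : (Fin n → ℤ) → Fin n × ℤˣ)
    (hodd : ∀ v : Fin n → ℤ, (∀ c, |v c| ≤ N) → (∃ c, |v c| = N) → lab (-v) = opp (lab v)) :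
    ∃ v w : Fin n → ℤ, (∀ c, |v c| ≤ N) ∧ (∀ c, |w c| ≤ N) ∧ (∀ c, |v c - w c| ≤ 1) ∧
      lab v = opp (lab w) := by
  by_contra hcon
  have hcompl : ∀ v w : Fin n → ℤ, (∀ c, |v c| ≤ N) → (∀ c, |w c| ≤ N) →
      (∀ c, |v c - w c| ≤ 1) → lab v ≠ opp (lab w) :=
    fun v w hv hw hvw h => hcon ⟨v, w, hv, hw, hvw, h⟩
  have h0 : (fullSimplices N 0 lab).card = 1 := by
    refine Finset.card_eq_one.2 ⟨(Fin.elim0, 0), ?_⟩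
    ext ⟨m, u⟩
    rw [mem_fullSimplices, Finset.mem_singleton, Prod.ext_iff]
    constructor
    · rintro ⟨⟨-, -, h⟩, -⟩
      exact ⟨Subsingleton.elim _ _, funext fun c => h c fun i => i.elim0⟩
    · rintro ⟨-, hu⟩
      refine ⟨⟨fun i => i.elim0, fun i => i.elim0, fun c _ => congrFun hu c⟩, by simp, ?_⟩
      exact fun i j _ => Subsingleton.elim (α := Fin 1) i j
  have hodd' : ∀ k, ((fullSimplices N k lab).card : ZMod 2) = 1 := by
    intro k
    induction k with
    | zero => simp [h0]
    | succ k ih => rw [card_fullSimplices_succ hN hodd hcompl, ih]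
  have hn : fullSimplices N (n + 1) lab = ∅ := by
    refine Finset.eq_empty_of_forall_notMem fun p hp => ?_
    have := Fintype.card_le_of_injective _ (mem_fullSimplices.1 hp).1.1
    simp at this
  simpa [hn] using hodd' (n + 1)

end SignedLattice

/-- A continuous self-map of the unit cube which is odd on the boundary has a zero. -/
theorem exists_zero_of_odd_on_sphere {m : ℕ} (f : (Fin m → ℝ) → (Fin m → ℝ))
    (hf : ContinuousOn f (Metric.closedBall 0 1)) (hodd : ∀ x, ‖x‖ = 1 → f (-x) = -f x) :
    ∃ x, ‖x‖ ≤ 1 ∧ f x = 0 := by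
  classical
  by_contra hcon
  push Not at hcon
  have hcpt : IsCompact (Metric.closedBall (0 : Fin m → ℝ) 1) := isCompact_closedBall 0 1
  obtain ⟨x₀, hx₀, hmin⟩ := hcpt.exists_isMinOn ⟨0, by simp⟩ hf.norm
  set ε : ℝ := ‖f x₀‖ with hε
  have hεpos : 0 < ε := norm_pos_iff.2 (hcon x₀ (by simpa using hx₀))
  have hle : ∀ x, ‖x‖ ≤ 1 → ∃ i, ε ≤ |f x i| := by
    intro x hx
    by_contra! h
    have : ‖f x‖ < ε := (pi_norm_lt_iff hεpos).2 fun i => h i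
    exact absurd (hmin (show x ∈ Metric.closedBall 0 1 by simpa using hx)) (not_le.2 this)
  have : Nonempty (Fin m) := ⟨(hle 0 (by simp)).choose⟩
  obtain ⟨δ, hδ, hunif⟩ := Metric.uniformContinuousOn_iff.1
    (hcpt.uniformContinuousOn_of_continuous hf) ε hεpos
  obtain ⟨N, hN⟩ := exists_nat_gt (1 / δ)
  have hNpos : (0 : ℝ) < N := lt_trans (by positivity) hN
  let pt : (Fin m → ℤ) → (Fin m → ℝ) := fun v c => (v c : ℝ) / N
  let idx : (Fin m → ℝ) → Fin m := fun z => Classical.epsilon fun i => ε ≤ z i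
  let lab : (Fin m → ℤ) → Fin m × ℤˣ := fun v =>
    (idx (fun c => |f (pt v) c|),
      if 0 < f (pt v) (idx (fun c => |f (pt v) c|)) then 1 else -1)
  have hpt : ∀ v : Fin m → ℤ, (∀ c, |v c| ≤ N) → ‖pt v‖ ≤ 1 := by
    intro v hv
    refine (pi_norm_le_iff_of_nonneg zero_le_one).2 fun c => ?_
    rw [Real.norm_eq_abs, abs_div, Nat.abs_cast, div_le_one hNpos]
    exact_mod_cast hv c
  have hlab : ∀ v : Fin m → ℤ, (∀ c, |v c| ≤ N) → ε ≤ |f (pt v) (lab v).1| := fun v hv =>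
    Classical.epsilon_spec (hle (pt v) (hpt v hv))
  obtain ⟨v, w, hv, hw, hvw, hl⟩ := SignedLattice.exists_complementary (N := N)
    (by exact_mod_cast hNpos) lab (by
      rintro v hv ⟨c, hc⟩
      have hneg : pt (-v) = -pt v := by ext c; simp [pt, neg_div]
      have hnorm : ‖pt v‖ = 1 := by
        refine le_antisymm (hpt v hv) ?_
        refine le_trans ?_ (norm_le_pi_norm (pt v) c)
        rw [Real.norm_eq_abs, abs_div, Nat.abs_cast, one_le_div hNpos]
        exact_mod_cast hc.ge
      have h1 : (lab (-v)).1 = (lab v).1 := by simp [lab, hneg, hodd _ hnorm]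
      have h2 := hlab v hv
      refine Prod.ext h1 ?_
      change (if 0 < f (pt (-v)) (lab (-v)).1 then (1 : ℤˣ) else -1) =
        -(if 0 < f (pt v) (lab v).1 then (1 : ℤˣ) else -1)
      rw [h1, hneg, hodd _ hnorm]
      rcases lt_trichotomy (f (pt v) (lab v).1) 0 with h | h | h
      · simp [h, not_lt.2 h.le]
      · simp [h] at h2; linarith
      · simp [h, not_lt.2 h.le])
  have hdist : dist (pt v) (pt w) < δ := by
    refine (dist_pi_lt_iff hδ).2 fun c => ?_
    rw [Real.dist_eq, ← sub_div, abs_div, Nat.abs_cast]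
    have : |(v c : ℝ) - w c| ≤ 1 := by exact_mod_cast hvw c
    calc |(v c : ℝ) - w c| / N ≤ 1 / N := by gcongr
      _ < δ := by rw [div_lt_iff₀ hNpos]; rw [div_lt_iff₀ hδ] at hN; linarith
  have hd := hunif (pt v) (by simpa using hpt v hv) (pt w) (by simpa using hpt w hw) hdist
  have hd' := lt_of_le_of_lt (dist_le_pi_dist (f (pt v)) (f (pt w)) (lab v).1) hd
  have h1 : (lab v).1 = (lab w).1 := (Prod.ext_iff.1 hl).1
  have h2 : (if 0 < f (pt v) (lab v).1 then (1 : ℤˣ) else -1) =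
      -(if 0 < f (pt w) (lab w).1 then (1 : ℤˣ) else -1) := (Prod.ext_iff.1 hl).2
  have hv' := hlab v hv
  have hw' := hlab w hw
  rw [← h1] at h2 hw'
  rw [Real.dist_eq, abs_lt] at hd'
  split_ifs at h2 with ha hb hb
  · exact absurd h2 (by decide)
  · rw [abs_of_pos ha] at hv'
    rw [abs_of_nonpos (not_lt.1 hb)] at hw'
    linarith
  · rw [abs_of_nonpos (not_lt.1 ha)] at hv'
    rw [abs_of_pos hb] at hw'
    linarith
  · exact absurd h2 (by decide)

/-- **Borsuk–Ulam theorem**: an odd continuous map `ℝᵐ⁺¹ \ {0} → ℝᵐ` has a zero. -/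
theorem exists_zero_of_odd {m : ℕ} (g : (Fin (m + 1) → ℝ) → (Fin m → ℝ))
    (hg : ContinuousOn g {0}ᶜ) (hodd : ∀ x, x ≠ 0 → g (-x) = -g x) :
    ∃ x, x ≠ 0 ∧ g x = 0 := by
  let p : (Fin m → ℝ) → (Fin (m + 1) → ℝ) := fun x => Fin.snoc x (1 - ‖x‖)
  have hp : Continuous p := by
    refine continuous_pi fun i => ?_
    refine Fin.lastCases ?_ (fun i => ?_) i
    · simp only [p, Fin.snoc_last]
      fun_prop
    · simpa [p] using continuous_apply i
  have hp0 : ∀ x, p x ≠ 0 := by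
    intro x hx
    have h1 : x = 0 := by
      ext i; simpa [p] using congrFun hx i.castSucc
    have h2 := congrFun hx (Fin.last m)
    simp [p, h1] at h2
  obtain ⟨x, -, hx⟩ := exists_zero_of_odd_on_sphere (fun x => g (p x))
    (hg.comp hp.continuousOn fun x _ => hp0 x) (by
      intro x hx
      have : p (-x) = -p x := by
        ext i; refine Fin.lastCases ?_ (fun i => ?_) i <;> simp [p, hx]
      rw [this, hodd _ (hp0 x)])
  exact ⟨p x, hp0 x, hx⟩

/-- Brezis–Browder ordering principle: a transitive relation with closed sections along which a
bounded below function decreases at least proportionally to the distance has maximal elements. -/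
theorem exists_maximal_of_decrease {E : Type*} [MetricSpace E] [CompleteSpace E]
    (r : E → E → Prop) (hrefl : ∀ x, r x x) (htrans : ∀ x y z, r x y → r y z → r x z)
    (hclosed : ∀ x, IsClosed {y | r x y}) (Φ : E → ℝ) (hΦ : BddBelow (Set.range Φ))
    {κ : ℝ} (hκ : 0 < κ) (hdec : ∀ x y, r x y → κ * dist x y ≤ Φ x - Φ y) (x₀ : E) :
    ∃ x, r x₀ x ∧ ∀ y, r x y → y = x := by
  obtain ⟨B, hB⟩ := hΦ
  have hex : ∀ (x : E) (n : ℕ), ∃ y, r x y ∧ ∀ z, r x z → Φ y ≤ Φ z + (1 / 2 : ℝ) ^ n := by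
    intro x n
    have hne : (Φ '' {z | r x z}).Nonempty := ⟨Φ x, x, hrefl x, rfl⟩
    have hbd : BddBelow (Φ '' {z | r x z}) := ⟨B, by
      rintro _ ⟨z, -, rfl⟩
      exact hB ⟨z, rfl⟩⟩
    obtain ⟨_, ⟨y, hy, rfl⟩, hlt⟩ := exists_lt_of_csInf_lt hne
      (lt_add_of_pos_right (sInf (Φ '' {z | r x z})) (by positivity : (0 : ℝ) < (1 / 2) ^ n))
    refine ⟨y, hy, fun z hz => ?_⟩
    have := csInf_le hbd ⟨z, hz, rfl⟩
    linarith
  choose next hnext hmin using hex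
  let u : ℕ → E := fun n => Nat.rec x₀ (fun k x => next x k) n
  have hu : ∀ n, u (n + 1) = next (u n) n := fun _ => rfl
  have hmono : ∀ n k, r (u n) (u (n + k)) := by
    intro n k
    induction k with
    | zero => exact hrefl _
    | succ k ih => exact htrans _ _ _ ih (hnext _ _)
  have hkey : ∀ n y, r (u (n + 1)) y → dist (u (n + 1)) y ≤ κ⁻¹ * (1 / 2 : ℝ) ^ n := by
    intro n y hy
    have h1 := hdec _ _ hy
    have h2 := hmin (u n) n y (htrans _ _ _ (hnext _ _) hy)
    rw [← hu] at h2
    rw [inv_mul_eq_div, le_div_iff₀ hκ]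
    linarith
  have hcau : CauchySeq (fun n => u (n + 1)) :=
    cauchySeq_of_le_geometric (1 / 2) κ⁻¹ (by norm_num) fun n => hkey n _ (hnext _ _)
  obtain ⟨x, hx⟩ := cauchySeq_tendsto_of_complete hcau
  have hrx : ∀ n, r (u n) x := fun n =>
    (hclosed (u n)).mem_of_tendsto hx <| Filter.eventually_atTop.2 ⟨n, fun k hk => by
      have := hmono n (k + 1 - n)
      rwa [show n + (k + 1 - n) = k + 1 by omega] at this⟩
  refine ⟨x, hrx 0, fun y hy => ?_⟩
  have hlim : Filter.Tendsto (fun n : ℕ => κ⁻¹ * (1 / 2 : ℝ) ^ n) Filter.atTop (nhds 0) := by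
    simpa using (tendsto_pow_atTop_nhds_zero_of_lt_one (r := (1 / 2 : ℝ)) (by norm_num)
      (by norm_num)).const_mul κ⁻¹
  have hy' : Filter.Tendsto (fun n => u (n + 1)) Filter.atTop (nhds y) :=
    tendsto_iff_dist_tendsto_zero.2 <| squeeze_zero (fun _ => dist_nonneg)
      (fun n => hkey n y (htrans _ _ _ (hrx (n + 1)) hy)) hlim
  exact tendsto_nhds_unique hy' hx

theorem ContinuousLinearMap.exists_one_lt_apply {X : Type*} [NormedAddCommGroup X]
    [NormedSpace ℝ X] (L : X →L[ℝ] ℝ) (hL : L ≠ 0) : ∃ v, 1 < L v ∧ ‖L‖ * ‖v‖ < 2 := by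
  have hpos : 0 < ‖L‖ := norm_pos_iff.2 hL
  obtain ⟨x, hx⟩ := L.exists_mul_lt_of_lt_opNorm (r := 2 / 3 * ‖L‖) (by positivity)
    (by linarith)
  have hLx : 0 < ‖L x‖ := lt_of_le_of_lt (by positivity) hx
  have hne : L x ≠ 0 := norm_pos_iff.1 hLx
  refine ⟨(4 / 3 / L x) • x, ?_, ?_⟩
  · rw [map_smul, smul_eq_mul, div_mul_cancel₀ _ hne]
    norm_num
  · rw [norm_smul, norm_div, ← mul_assoc, mul_comm ‖L‖, mul_assoc, div_mul_eq_mul_div,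
      div_lt_iff₀ hLx, Real.norm_of_nonneg (by norm_num : (0 : ℝ) ≤ 4 / 3)]
    linarith

theorem fderiv_neg_of_even {X : Type*} [NormedAddCommGroup X] [NormedSpace ℝ X] {J : X → ℝ}
    (hJ : Differentiable ℝ J) (heven : ∀ u, J (-u) = J u) (x : X) :
    fderiv ℝ J (-x) = -fderiv ℝ J x := by
  have h := (hJ (-x)).hasFDerivAt.comp x (hasFDerivAt_id (𝕜 := ℝ) x).neg
  have he : J ∘ (fun y => -y) = J := funext heven
  ext v
  have h2 := congrArg (fun L => L v) ((he ▸ h : HasFDerivAt J _ x)).fderiv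
  simp only [ContinuousLinearMap.comp_apply, neg_apply,
    ContinuousLinearMap.id_apply, map_neg] at h2 ⊢
  linarith

/-- Along an odd map avoiding the critical points of an even functional there is an odd
pseudo-gradient field. -/
theorem exists_odd_pseudoGradient {X : Type*} [NormedAddCommGroup X] [NormedSpace ℝ X]
    {J : X → ℝ} (hJ : ContDiff ℝ 1 J) (heven : ∀ u, J (-u) = J u)
    {B : Type*} [TopologicalSpace B] [CompactSpace B] [T2Space B] (ν : C(B, B))
    (hν : ∀ a, ν (ν a) = a) (φ : C(B, X)) (hφ : ∀ a, φ (ν a) = -φ a)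
    (hcrit : ∀ a, fderiv ℝ J (φ a) ≠ 0) :
    ∃ V : C(B, X), (∀ a, V (ν a) = -V a) ∧
      ∀ a, 1 < fderiv ℝ J (φ a) (V a) ∧ ‖fderiv ℝ J (φ a)‖ * ‖V a‖ < 2 := by
  have hcont : Continuous fun a => fderiv ℝ J (φ a) :=
    (hJ.continuous_fderiv one_ne_zero).comp φ.continuous
  have hconv : ∀ a, Convex ℝ {v | 1 < fderiv ℝ J (φ a) v ∧ ‖fderiv ℝ J (φ a)‖ * ‖v‖ < 2} := by
    intro a
    refine (convex_halfSpace_gt (fderiv ℝ J (φ a)).toLinearMap.isLinear 1).inter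
      (t := {v | ‖fderiv ℝ J (φ a)‖ * ‖v‖ < 2}) ?_
    rintro x hx y hy s t hs ht hst
    rw [Set.mem_ofPred_eq] at *
    calc ‖fderiv ℝ J (φ a)‖ * ‖s • x + t • y‖
        ≤ ‖fderiv ℝ J (φ a)‖ * (s * ‖x‖ + t * ‖y‖) := by
          gcongr
          refine (norm_add_le _ _).trans_eq ?_
          rw [norm_smul, norm_smul, Real.norm_of_nonneg hs, Real.norm_of_nonneg ht]
      _ = s * (‖fderiv ℝ J (φ a)‖ * ‖x‖) + t * (‖fderiv ℝ J (φ a)‖ * ‖y‖) := by ring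
      _ < 2 := by
          rcases hs.eq_or_lt with rfl | hs'
          · obtain rfl : t = 1 := by linarith
            linarith
          · nlinarith
  obtain ⟨W, hW⟩ := exists_continuous_forall_mem_convex_of_local_const hconv (by
    intro a
    obtain ⟨v, hv1, hv2⟩ := (fderiv ℝ J (φ a)).exists_one_lt_apply (hcrit a)
    refine ⟨v, ?_⟩
    have c1 : Continuous fun a => fderiv ℝ J (φ a) v := hcont.clm_apply continuous_const
    have c2 : Continuous fun a => ‖fderiv ℝ J (φ a)‖ * ‖v‖ := hcont.norm.mul continuous_const
    exact (c1.continuousAt.eventually_const_lt hv1).and (c2.continuousAt.eventually_lt_const hv2))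
  refine ⟨(1 / 2 : ℝ) • (W - W.comp ν), fun a => ?_, fun a => ?_⟩
  · simp only [ContinuousMap.smul_apply, ContinuousMap.sub_apply, ContinuousMap.comp_apply, hν]
    rw [← smul_neg, neg_sub]
  · have h1 := hW (ν a)
    have h2 : -W (ν a) ∈ {v | 1 < fderiv ℝ J (φ a) v ∧ ‖fderiv ℝ J (φ a)‖ * ‖v‖ < 2} := by
      simpa only [hφ, fderiv_neg_of_even (hJ.differentiable one_ne_zero) heven,
        Set.mem_ofPred_eq, norm_neg, map_neg, neg_apply] using h1
    have h3 := hconv a (hW a) h2 (by norm_num : (0 : ℝ) ≤ 1 / 2) (by norm_num : (0 : ℝ) ≤ 1 / 2)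
      (by norm_num)
    rwa [← smul_add, ← sub_eq_add_neg] at h3

theorem exists_uniform_decrease {X : Type*} [NormedAddCommGroup X] [NormedSpace ℝ X]
    {J : X → ℝ} (hJ : ContDiff ℝ 1 J) {B : Type*} [TopologicalSpace B] [CompactSpace B]
    (φ V : C(B, X)) (hV : ∀ a, 1 < fderiv ℝ J (φ a) (V a)) :
    ∃ δ > 0, ∀ t, 0 ≤ t → t < δ → ∀ a, J (φ a - t • V a) ≤ J (φ a) - t := by
  have hcont : Continuous fun p : ℝ × B => fderiv ℝ J (φ p.2 - p.1 • V p.2) (V p.2) :=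
    ((hJ.continuous_fderiv one_ne_zero).comp (by fun_prop)).clm_apply (by fun_prop)
  have hev : ∀ᶠ s in nhds (0 : ℝ), ∀ a ∈ (Set.univ : Set B),
      1 < fderiv ℝ J (φ a - s • V a) (V a) := by
    refine isCompact_univ.eventually_forall_of_forall_eventually fun a _ => ?_
    refine hcont.continuousAt.eventually_const_lt ?_
    simpa using hV a
  obtain ⟨δ, hδ, hball⟩ := Metric.eventually_nhds_iff.1 hev
  refine ⟨δ, hδ, fun t ht htδ a => ?_⟩
  have hd : ∀ s, HasDerivAt (fun s : ℝ => J (φ a - s • V a) + s)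
      (fderiv ℝ J (φ a - s • V a) (-((1 : ℝ) • V a)) + 1) s := by
    intro s
    have h1 : HasDerivAt (fun s : ℝ => φ a - s • V a) (-((1 : ℝ) • V a)) s :=
      ((hasDerivAt_id s).smul_const (V a)).const_sub (φ a)
    exact (((hJ.differentiable one_ne_zero) _).hasFDerivAt.comp_hasDerivAt s h1).add
      (hasDerivAt_id s)
  have hanti : AntitoneOn (fun s : ℝ => J (φ a - s • V a) + s) (Set.Icc 0 t) := by
    refine antitoneOn_of_deriv_nonpos (convex_Icc 0 t)
      (fun s _ => (hd s).continuousAt.continuousWithinAt)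
      (fun s _ => (hd s).differentiableAt.differentiableWithinAt) fun s hs => ?_
    rw [interior_Icc] at hs
    rw [(hd s).deriv, one_smul, map_neg]
    have := hball (y := s) (by
      rw [Real.dist_eq, sub_zero, abs_of_pos hs.1]
      exact hs.2.trans htδ) a trivial
    linarith
  have := hanti (Set.left_mem_Icc.2 ht) (Set.right_mem_Icc.2 ht) ht
  simp only [zero_smul, sub_zero, add_zero] at this
  linarith

open Metric in
/-- Quantitative odd deformation away from a set `K`. The amount `b / 4 * ρ` of the decrease does
not depend on the level `c`, although the gradient bound `b'` near the origin does. -/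
theorem exists_odd_deformation {X : Type*} [NormedAddCommGroup X] [NormedSpace ℝ X]
    [CompleteSpace X] {J : X → ℝ} (hJ : ContDiff ℝ 1 J) (heven : ∀ u, J (-u) = J u)
    (hbdd : BddBelow (Set.range J)) {K : Set X} {ρ b b' c : ℝ}
    (hρ : 0 < ρ) (hb : 0 < b) (hb' : 0 < b') (hc : c < 0)
    (hKρ : ∀ x, ‖x‖ ≤ ρ → 2 * ρ ≤ infDist x K)
    (hgrad : ∀ x, J x ≤ 0 → ρ ≤ infDist x K → ρ / 2 ≤ ‖x‖ → b ≤ ‖fderiv ℝ J x‖)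
    (hgrad' : ∀ x, J x ≤ c → ρ ≤ infDist x K → b' ≤ ‖fderiv ℝ J x‖)
    {B : Type*} [TopologicalSpace B] [CompactSpace B] [T2Space B] (ν : C(B, B))
    (hν : ∀ a, ν (ν a) = a) (α : C(B, X)) (hα : ∀ a, α (ν a) = -α a)
    (hαc : ∀ a, J (α a) ≤ c) (hαK : ∀ a, 2 * ρ ≤ infDist (α a) K) :
    ∃ φ : C(B, X), (∀ a, φ (ν a) = -φ a) ∧ ∀ a, J (φ a) ≤ J (α a) - b / 4 * ρ := by
  rcases isEmpty_or_nonempty B with hB | ⟨⟨a₀⟩⟩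
  · exact ⟨α, hα, fun a => hB.elim a⟩
  set κ : ℝ := min b b' / 4 with hκdef
  have hκ : 0 < κ := by positivity
  have hκb : κ ≤ b / 4 := by
    rw [hκdef]
    gcongr
    exact min_le_left _ _
  have hκb' : κ ≤ b' / 4 := by
    rw [hκdef]
    gcongr
    exact min_le_right _ _
  let m : X → ℝ := fun x => b / 4 * min (infDist x K) (2 * ρ)
  have hmcont : Continuous m := by
    have := continuous_infDist_pt K
    fun_prop
  have hmlip : ∀ x y, |m x - m y| ≤ b / 4 * ‖x - y‖ := by
    intro x y
    rw [← mul_sub, abs_mul, abs_of_pos (by positivity : 0 < b / 4)]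
    gcongr
    refine (abs_min_sub_min_le_max _ _ _ _).trans ?_
    rw [sub_self, abs_zero, max_eq_left (abs_nonneg _), ← dist_eq_norm, ← Real.dist_eq]
    exact (lipschitz_infDist_pt K).dist_le_mul x y |>.trans_eq (by simp)
  let d : X → X → ℝ := fun x y => κ * ‖x - y‖ + |m x - m y|
  have hd0 : ∀ x y, 0 ≤ d x y := fun x y => by positivity
  have hdtri : ∀ x y z, d x z ≤ d x y + d y z := by
    intro x y z
    have h1 := norm_sub_le_norm_sub_add_norm_sub x y z
    have h2 := abs_sub_le (m x) (m y) (m z)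
    have h3 := mul_le_mul_of_nonneg_left h1 hκ.le
    simp only [d]
    linarith
  let r : C(B, X) → C(B, X) → Prop := fun φ ψ =>
    ((∀ a, φ (ν a) = -φ a) → ∀ a, ψ (ν a) = -ψ a) ∧
      ∀ a a', J (ψ a) + d (φ a') (ψ a') ≤ J (φ a)
  have hrefl : ∀ φ, r φ φ := fun φ => ⟨id, fun a a' => by simp [d]⟩
  have htrans : ∀ φ ψ χ, r φ ψ → r ψ χ → r φ χ := by
    intro φ ψ χ h1 h2
    refine ⟨fun h => h2.1 (h1.1 h), fun a a' => ?_⟩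
    have := hdtri (φ a') (ψ a') (χ a')
    linarith [h1.2 a a', h2.2 a a']
  have hclosed : ∀ φ, IsClosed {ψ | r φ ψ} := by
    intro φ
    have h1 : IsClosed {ψ : C(B, X) | (∀ a, φ (ν a) = -φ a) → ∀ a, ψ (ν a) = -ψ a} := by
      by_cases h : ∀ a, φ (ν a) = -φ a
      · simp only [h, implies_true, forall_const, Set.ofPred_forall]
        exact isClosed_iInter fun a => isClosed_eq (continuous_eval_const _)
          (continuous_eval_const _).neg
      · simp [h]
    refine h1.inter (?_ : IsClosed {ψ : C(B, X) | ∀ a a', J (ψ a) + d (φ a') (ψ a') ≤ J (φ a)})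
    simp only [Set.ofPred_forall]
    refine isClosed_iInter fun a => isClosed_iInter fun a' => isClosed_le ?_ continuous_const
    have e1 : Continuous fun ψ : C(B, X) => ψ a := continuous_eval_const _
    have e2 : Continuous fun ψ : C(B, X) => ψ a' := continuous_eval_const _
    have := hJ.continuous
    simp only [d]
    fun_prop
  have hdec : ∀ φ ψ, r φ ψ → κ * dist φ ψ ≤ J (φ a₀) - J (ψ a₀) := by
    intro φ ψ h
    have h0 : ∀ a', κ * dist (φ a') (ψ a') ≤ J (φ a₀) - J (ψ a₀) := fun a' => by
      have h1 := h.2 a₀ a'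
      have h2 := abs_nonneg (m (φ a') - m (ψ a'))
      simp only [d] at h1
      rw [dist_eq_norm]
      linarith
    have h3 : dist φ ψ ≤ (J (φ a₀) - J (ψ a₀)) / κ := by
      refine (ContinuousMap.dist_le ?_).2 fun a' => ?_
      · have := h0 a₀
        exact div_nonneg (le_trans (by positivity) this) hκ.le
      · rw [le_div_iff₀' hκ]
        exact h0 a'
    rwa [le_div_iff₀' hκ] at h3
  have hΦ : BddBelow (Set.range fun φ : C(B, X) => J (φ a₀)) :=
    hbdd.mono (by rintro _ ⟨φ, rfl⟩; exact ⟨_, rfl⟩)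
  obtain ⟨φ, ⟨hodd, hdφ⟩, hmax⟩ :=
    exists_maximal_of_decrease r hrefl htrans hclosed _ hΦ hκ hdec α
  have hφodd := hodd hα
  refine ⟨φ, hφodd, ?_⟩
  by_cases hnear : ∃ a', infDist (φ a') K ≤ ρ
  · obtain ⟨a', ha'⟩ := hnear
    intro a
    have h1 := hdφ a a'
    have h2 : m (α a') = b / 4 * (2 * ρ) := by
      simp only [m]
      rw [min_eq_right (hαK a')]
    have h3 : m (φ a') ≤ b / 4 * ρ := by
      simp only [m]
      gcongr
      exact (min_le_left _ _).trans ha'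
    have h4 := le_abs_self (m (α a') - m (φ a'))
    have h5 : 0 ≤ κ * ‖α a' - φ a'‖ := by positivity
    simp only [d] at h1
    linarith
  exfalso
  push Not at hnear
  have hφc : ∀ a, J (φ a) ≤ c := fun a => by
    have := hdφ a a
    linarith [hd0 (α a) (φ a), hαc a]
  have hφb' : ∀ a, b' ≤ ‖fderiv ℝ J (φ a)‖ := fun a => hgrad' _ (hφc a) (hnear a).le
  obtain ⟨V, hVodd, hV⟩ := exists_odd_pseudoGradient hJ heven ν hν φ hφodd
    fun a => norm_pos_iff.1 (hb'.trans_le (hφb' a))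
  obtain ⟨δ, hδ, hdecr⟩ := exists_uniform_decrease hJ φ V fun a => (hV a).1
  set t : ℝ := min (δ / 2) (ρ * b' / 4) with htdef
  have ht : 0 < t := by positivity
  have htδ : t < δ := (min_le_left _ _).trans_lt (by linarith)
  have htρ : t ≤ ρ * b' / 4 := min_le_right _ _
  have hVb : ∀ a s, 0 < s → s ≤ ‖fderiv ℝ J (φ a)‖ → s * ‖V a‖ ≤ 2 := fun a s _ hs =>
    (mul_le_mul_of_nonneg_right hs (norm_nonneg _)).trans (hV a).2.le
  have hcost : ∀ a', d (φ a') (φ a' - t • V a') ≤ t := by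
    intro a'
    have hdiff : ‖φ a' - (φ a' - t • V a')‖ = t * ‖V a'‖ := by
      rw [sub_sub_cancel, norm_smul, Real.norm_of_nonneg ht.le]
    have hV1 := hVb a' b' hb' (hφb' a')
    rcases lt_or_ge ‖φ a'‖ (ρ / 2) with hlt | hge
    · have h1 : t * ‖V a'‖ ≤ ρ / 2 := by
        calc t * ‖V a'‖ ≤ ρ * b' / 4 * ‖V a'‖ := by gcongr
          _ = ρ / 4 * (b' * ‖V a'‖) := by ring
          _ ≤ ρ / 4 * 2 := by gcongr
          _ = ρ / 2 := by ring
      have h2 : ‖φ a' - t • V a'‖ ≤ ρ := by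
        refine (norm_sub_le _ _).trans ?_
        rw [norm_smul, Real.norm_of_nonneg ht.le]
        linarith
      have h3 : m (φ a') = m (φ a' - t • V a') := by
        simp only [m]
        rw [min_eq_right (hKρ _ h2), min_eq_right (hKρ _ (by linarith))]
      simp only [d]
      rw [h3, sub_self, abs_zero, add_zero, hdiff]
      calc κ * (t * ‖V a'‖) ≤ b' / 4 * (t * ‖V a'‖) := by gcongr
        _ = t / 4 * (b' * ‖V a'‖) := by ring
        _ ≤ t / 4 * 2 := by gcongr
        _ ≤ t := by linarith
    · have h1 := hVb a' b hb (hgrad _ ((hφc a').trans hc.le) (hnear a').le hge)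
      have h2 := hmlip (φ a') (φ a' - t • V a')
      simp only [d]
      rw [hdiff] at h2 ⊢
      calc κ * (t * ‖V a'‖) + |m (φ a') - m (φ a' - t • V a')|
          ≤ b / 4 * (t * ‖V a'‖) + b / 4 * (t * ‖V a'‖) := by gcongr
        _ = t / 2 * (b * ‖V a'‖) := by ring
        _ ≤ t / 2 * 2 := by gcongr
        _ = t := by ring
  have hr : r φ (φ - t • V) := by
    refine ⟨fun _ a => ?_, fun a a' => ?_⟩
    · simp only [ContinuousMap.sub_apply, ContinuousMap.smul_apply, hφodd, hVodd]
      module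
    · have h1 := hdecr t ht.le htδ a
      have h2 := hcost a'
      simp only [ContinuousMap.sub_apply, ContinuousMap.smul_apply]
      linarith
  have h0 := congrArg (fun ψ : C(B, X) => ψ a₀) (hmax _ hr)
  have h1 := hdecr t ht.le htδ a₀
  simp only [ContinuousMap.sub_apply, ContinuousMap.smul_apply] at h0
  rw [h0] at h1
  linarith

open Metric in
/-- An odd map into a region where `J` is negative and at most `j` deformation steps above its
infimum has index at most `j * m`. -/
theorem exists_odd_nonvanishing {X : Type*} [NormedAddCommGroup X] [NormedSpace ℝ X]
    [CompleteSpace X] {J : X → ℝ} (hJ : ContDiff ℝ 1 J) (heven : ∀ u, J (-u) = J u)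
    {L : ℝ} (hL : ∀ x, L ≤ J x) {K : Set X} {ρ b c : ℝ}
    (hρ : 0 < ρ) (hb : 0 < b) (hc : c < 0)
    (hKρ : ∀ x, ‖x‖ ≤ ρ → 2 * ρ ≤ infDist x K) (hKneg : ∀ x, infDist (-x) K = infDist x K)
    (hgrad : ∀ x, J x ≤ 0 → ρ ≤ infDist x K → ρ / 2 ≤ ‖x‖ → b ≤ ‖fderiv ℝ J x‖)
    (hgrad' : ∃ b' > 0, ∀ x, J x ≤ c → ρ ≤ infDist x K → b' ≤ ‖fderiv ℝ J x‖)
    {m : ℕ} (ℓ : Fin m → X →L[ℝ] ℝ) (hℓ : ∀ x, infDist x K ≤ 2 * ρ → ∃ i, ℓ i x ≠ 0)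
    (j : ℕ) {B : Type*} [TopologicalSpace B] [CompactSpace B] [T2Space B] (ν : C(B, B))
    (hν : ∀ a, ν (ν a) = a) (α : C(B, X)) (hα : ∀ a, α (ν a) = -α a)
    (hαc : ∀ a, J (α a) ≤ c) (hαj : ∀ a, J (α a) < L + j * (b / 4 * ρ)) :
    ∃ f : C(B, Fin j → Fin m → ℝ), (∀ a, f (ν a) = -f a) ∧ ∀ a, f a ≠ 0 := by
  induction j generalizing B with
  | zero =>
    have hB : IsEmpty B := ⟨fun a => by
      have := hαj a
      have := hL (α a)
      simp only [Nat.cast_zero, zero_mul, add_zero] at *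
      linarith⟩
    exact ⟨0, fun a => hB.elim a, fun a => hB.elim a⟩
  | succ j ih =>
    have hclosed : IsClosed {a : B | 2 * ρ ≤ infDist (α a) K} :=
      isClosed_le continuous_const ((continuous_infDist_pt K).comp α.continuous)
    set S : Set B := {a : B | 2 * ρ ≤ infDist (α a) K} with hS
    have hνS : ∀ a ∈ S, ν a ∈ S := fun a ha => by
      change 2 * ρ ≤ infDist (α (ν a)) K
      rw [hα, hKneg]
      exact ha
    have : CompactSpace S := isCompact_iff_compactSpace.1 hclosed.isCompact
    obtain ⟨b', hb', hgrad'⟩ := hgrad'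
    let νS : C(S, S) := ⟨fun a => ⟨ν a, hνS a a.2⟩, by fun_prop⟩
    have hνS2 : ∀ a, νS (νS a) = a := fun a => Subtype.ext (hν a)
    obtain ⟨φ, hφodd, hφ⟩ := exists_odd_deformation hJ heven ⟨L, by rintro _ ⟨x, rfl⟩; exact hL x⟩
      hρ hb hb' hc hKρ hgrad hgrad' νS hνS2 (α.restrict S) (fun a => hα a) (fun a => hαc a)
      (fun a => a.2)
    have hβ : 0 < b / 4 * ρ := by positivity
    obtain ⟨f, hfodd, hf⟩ := ih νS hνS2 φ hφodd
      (fun a => (hφ a).trans (by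
        have := hαc a
        simp only [ContinuousMap.restrict_apply]
        linarith))
      (fun a => (hφ a).trans_lt (by
        have := hαj a
        push_cast at this
        simp only [ContinuousMap.restrict_apply]
        linarith))
    obtain ⟨g, hg⟩ := f.exists_restrict_eq hclosed
    have hgS : ∀ a : S, g a = f a := fun a => by rw [← hg]; rfl
    refine ⟨⟨fun a => Fin.cons (fun i => ℓ i (α a)) ((1 / 2 : ℝ) • (g a - g (ν a))), ?_⟩,
      fun a => ?_, fun a h0 => ?_⟩
    · refine continuous_pi fun i => ?_
      refine Fin.cases ?_ (fun i => ?_) i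
      · simp only [Fin.cons_zero]
        fun_prop
      · simp only [Fin.cons_succ]
        fun_prop
    · ext i k
      refine Fin.cases ?_ (fun i => ?_) i
      · simp [hα]
      · simp [hν]
        ring
    · have hz : ∀ i, ℓ i (α a) = 0 := fun i => by
        simpa using congrFun (congrFun h0 0) i
      have ha : a ∈ S := by
        by_contra hn
        obtain ⟨i, hi⟩ := hℓ (α a) (not_le.1 hn).le
        exact hi (hz i)
      refine hf ⟨a, ha⟩ ?_
      ext i k
      have h1 := congrFun (congrFun h0 i.succ) k
      have h2 : g (ν a) = -g a := by
        rw [hgS ⟨a, ha⟩, ← hfodd ⟨a, ha⟩]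
        exact hgS ⟨ν a, hνS a ha⟩
      rw [← hgS ⟨a, ha⟩]
      simp [h2] at h1 ⊢
      linarith

/-- An odd map from a sphere of a finite-dimensional normed space to a
coordinate space of smaller dimension has a zero. -/
theorem exists_zero_of_odd_on_normed_sphere {Y : Type*} [NormedAddCommGroup Y] [NormedSpace ℝ Y]
    {n : ℕ} [FiniteDimensional ℝ Y] (hY : Module.finrank ℝ Y = n + 1) {r : ℝ} (hr : 0 < r)
    (f : C(Metric.sphere (0 : Y) r, Fin n → ℝ)) (hodd : ∀ a, f (-a) = -f a) :
    ∃ a, f a = 0 := by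
  let e : (Fin (n + 1) → ℝ) ≃L[ℝ] Y :=
    ContinuousLinearEquiv.ofFinrankEq (by rw [hY, Module.finrank_fin_fun])
  have hmem : ∀ x, x ≠ 0 → (r / ‖e x‖) • e x ∈ Metric.sphere (0 : Y) r := by
    intro x hx
    have : 0 < ‖e x‖ := norm_pos_iff.2 fun h => hx (e.map_eq_zero_iff.1 h)
    rw [mem_sphere_zero_iff_norm, norm_smul, Real.norm_of_nonneg (by positivity),
      div_mul_cancel₀ _ this.ne']
  let p : ({0}ᶜ : Set (Fin (n + 1) → ℝ)) → Metric.sphere (0 : Y) r := fun x => ⟨_, hmem x x.2⟩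
  have hp : Continuous p := by
    refine Continuous.subtype_mk (Continuous.smul (continuous_const.div (by fun_prop) ?_)
      (by fun_prop)) _
    exact fun x h => x.2 (e.map_eq_zero_iff.1 (norm_eq_zero.1 h))
  classical
  let g : (Fin (n + 1) → ℝ) → (Fin n → ℝ) := fun x => if hx : x ≠ 0 then f (p ⟨x, hx⟩) else 0
  have hgp : ∀ x (hx : x ≠ 0), g x = f (p ⟨x, hx⟩) := fun x hx => dif_pos hx
  have hgc : ContinuousOn g {0}ᶜ := by
    rw [continuousOn_iff_continuous_domRestrict]
    exact (f.continuous.comp hp).congr fun x => (hgp x x.2).symm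
  obtain ⟨x, hx, hgx⟩ := exists_zero_of_odd g hgc fun x hx => by
    rw [hgp x hx, hgp (-x) (neg_ne_zero.2 hx), ← hodd]
    congr 1
    ext
    simp [p]
  exact ⟨_, (hgp x hx).symm.trans hgx⟩

theorem exists_gradient_bound {X : Type*} [NormedAddCommGroup X] [NormedSpace ℝ X] {J : X → ℝ}
    (hJ : ContDiff ℝ 1 J) (hbdd : BddBelow (Set.range J))
    (hPS : ∀ u : ℕ → X,
      (∃ C : ℝ, ∀ n : ℕ, |J (u n)| ≤ C) →
      Filter.Tendsto (fun n => fderiv ℝ J (u n)) Filter.atTop (nhds 0) →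
      ∃ φ : ℕ → ℕ, StrictMono φ ∧
        ∃ x : X, Filter.Tendsto (u ∘ φ) Filter.atTop (nhds x))
    {F : Set X} (hF : IsClosed F) (hF0 : ∀ x ∈ F, J x ≤ 0) (hcrit : ∀ x ∈ F, fderiv ℝ J x ≠ 0) :
    ∃ b > 0, ∀ x ∈ F, b ≤ ‖fderiv ℝ J x‖ := by
  by_contra! hcon
  choose u hu hlt using fun n : ℕ => hcon (1 / ((n : ℝ) + 1)) (by positivity)
  obtain ⟨L, hL⟩ := hbdd
  have hlim : Filter.Tendsto (fun n => fderiv ℝ J (u n)) Filter.atTop (nhds 0) :=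
    squeeze_zero_norm (fun n => (hlt n).le) tendsto_one_div_add_atTop_nhds_zero_nat
  obtain ⟨φ, hφ, x, hx⟩ := hPS u ⟨|L|, fun n => abs_le.2
    ⟨(neg_abs_le L).trans (hL ⟨_, rfl⟩), (hF0 _ (hu n)).trans (abs_nonneg L)⟩⟩ hlim
  refine hcrit x (hF.mem_of_tendsto hx (.of_forall fun n => hu _)) ?_
  exact tendsto_nhds_unique (((hJ.continuous_fderiv one_ne_zero).tendsto x).comp hx)
    (hlim.comp hφ.tendsto_atTop)

/-- A Palais–Smale functional which is bounded below has a compact set of critical points at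
nonpositive levels. -/
theorem isCompact_critical_of_palaisSmale {X : Type*} [NormedAddCommGroup X] [NormedSpace ℝ X]
    {J : X → ℝ} (hJ : ContDiff ℝ 1 J) (hbdd : BddBelow (Set.range J))
    (hPS : ∀ u : ℕ → X,
      (∃ C : ℝ, ∀ n : ℕ, |J (u n)| ≤ C) →
      Filter.Tendsto (fun n => fderiv ℝ J (u n)) Filter.atTop (nhds 0) →
      ∃ φ : ℕ → ℕ, StrictMono φ ∧
        ∃ x : X, Filter.Tendsto (u ∘ φ) Filter.atTop (nhds x)) :
    IsCompact {x | fderiv ℝ J x = 0 ∧ J x ≤ 0} := by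
  have hclosed : IsClosed {x | fderiv ℝ J x = 0 ∧ J x ≤ 0} :=
    (isClosed_eq (hJ.continuous_fderiv one_ne_zero) continuous_const).inter
      (isClosed_le hJ.continuous continuous_const)
  obtain ⟨L, hL⟩ := hbdd
  refine isCompact_iff_isSeqCompact.2 fun u hu => ?_
  obtain ⟨φ, hφ, x, hx⟩ := hPS u ⟨|L|, fun n => abs_le.2
    ⟨(neg_abs_le L).trans (hL ⟨_, rfl⟩), (hu n).2.trans (abs_nonneg L)⟩⟩
    (tendsto_const_nhds.congr fun n => (hu n).1.symm)
  exact ⟨x, hclosed.mem_of_tendsto hx (.of_forall fun n => hu _), φ, hφ, hx⟩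

open Metric in
theorem exists_small_critical_point {X : Type*} [NormedAddCommGroup X] [NormedSpace ℝ X]
    [CompleteSpace X] (hinf : ¬ FiniteDimensional ℝ X) {J : X → ℝ} (hJ : ContDiff ℝ 1 J)
    (heven : ∀ u, J (-u) = J u) (hbdd : BddBelow (Set.range J)) (hJ0 : J 0 = 0)
    (hPS : ∀ u : ℕ → X,
      (∃ C : ℝ, ∀ n : ℕ, |J (u n)| ≤ C) →
      Filter.Tendsto (fun n => fderiv ℝ J (u n)) Filter.atTop (nhds 0) →
      ∃ φ : ℕ → ℕ, StrictMono φ ∧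
        ∃ x : X, Filter.Tendsto (u ∘ φ) Filter.atTop (nhds x))
    (hJ2 : ∀ k : ℕ, ∃ (Xk : Submodule ℝ X) (r : ℝ),
      FiniteDimensional ℝ Xk ∧ Module.finrank ℝ Xk = k ∧ 0 < r ∧
      ∃ c : ℝ, c < 0 ∧ ∀ u : X, u ∈ Xk → ‖u‖ = r → J u ≤ c) {ε : ℝ} (hε : 0 < ε) :
    ∃ v, fderiv ℝ J v = 0 ∧ v ≠ 0 ∧ J v ≤ 0 ∧ ‖v‖ < ε := by
  by_contra! hcon
  have : Nontrivial X := by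
    by_contra h
    rw [not_nontrivial_iff_subsingleton] at h
    exact hinf inferInstance
  obtain ⟨z, hz⟩ := NormedSpace.exists_lt_norm ℝ X ε
  set K : Set X := ({x | fderiv ℝ J x = 0 ∧ J x ≤ 0} ∩ {x | ε ≤ ‖x‖}) ∪ {z, -z} with hK
  have hKc : IsCompact K :=
    ((isCompact_critical_of_palaisSmale hJ hbdd hPS).inter_right
      (isClosed_le continuous_const continuous_norm)).union (Set.toFinite _).isCompact
  have hKne : K.Nonempty := ⟨z, Or.inr (Or.inl rfl)⟩
  have hKε : ∀ x ∈ K, ε ≤ ‖x‖ := by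
    rintro x (hx | rfl | rfl)
    · exact hx.2
    · exact hz.le
    · rw [norm_neg]
      exact hz.le
  have hKmem : ∀ x ∈ K, -x ∈ K := by
    rintro x (hx | rfl | rfl)
    · refine Or.inl ⟨⟨?_, ?_⟩, ?_⟩
      · rw [fderiv_neg_of_even (hJ.differentiable one_ne_zero) heven, hx.1.1, neg_zero]
      · rw [heven]
        exact hx.1.2
      · change ε ≤ ‖-x‖
        rw [norm_neg]
        exact hx.2
    · exact Or.inr (Or.inr rfl)
    · exact Or.inr (Or.inl (neg_neg z))
  have hKle : ∀ x, infDist (-x) K ≤ infDist x K := fun x =>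
    (le_infDist hKne).2 fun {y} hy => by
      rw [← dist_neg_neg]
      exact infDist_le_dist_of_mem (hKmem y hy)
  have hKneg : ∀ x, infDist (-x) K = infDist x K := fun x =>
    (hKle x).antisymm (by simpa using hKle (-x))
  have hKcrit : ∀ x, fderiv ℝ J x = 0 → x ≠ 0 → J x ≤ 0 → infDist x K = 0 := fun x h1 h2 h3 =>
    infDist_zero_of_mem (Or.inl ⟨⟨h1, h3⟩, hcon x h1 h2 h3⟩)
  obtain ⟨T, hT⟩ := hKc.elim_finite_subcover (fun f : X →L[ℝ] ℝ => {x | f x ≠ 0})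
    (fun f => isOpen_ne_fun f.continuous continuous_const) fun x hx => by
      obtain ⟨f, hf⟩ := SeparatingDual.exists_ne_zero (R := ℝ)
        (norm_pos_iff.1 (hε.trans_le (hKε x hx)))
      exact Set.mem_iUnion.2 ⟨f, hf⟩
  obtain ⟨δ, hδ, hδT⟩ := hKc.exists_cthickening_subset_open
    (isOpen_biUnion fun f _ => isOpen_ne_fun f.continuous continuous_const) hT
  set ρ : ℝ := min (δ / 2) (ε / 3) with hρdef
  have hρ : 0 < ρ := by positivity
  have hρδ : 2 * ρ ≤ δ := by linarith [min_le_left (δ / 2) (ε / 3)]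
  have hρε : 3 * ρ ≤ ε := by linarith [min_le_right (δ / 2) (ε / 3)]
  have hKρ : ∀ x, ‖x‖ ≤ ρ → 2 * ρ ≤ infDist x K := fun x hx =>
    (le_infDist hKne).2 fun {y} hy => by
      rw [dist_comm, dist_eq_norm]
      linarith [norm_sub_norm_le y x, hKε y hy]
  have hinfc : Continuous fun x => infDist x K := continuous_infDist_pt K
  obtain ⟨b, hb, hgrad⟩ := exists_gradient_bound hJ hbdd hPS
    (F := {x | J x ≤ 0} ∩ ({x | ρ ≤ infDist x K} ∩ {x | ρ / 2 ≤ ‖x‖}))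
    ((isClosed_le hJ.continuous continuous_const).inter
      ((isClosed_le continuous_const hinfc).inter (isClosed_le continuous_const continuous_norm)))
    (fun x hx => hx.1) (fun x hx h0 => by
      have h1 : ρ ≤ infDist x K := hx.2.1
      have h2 : ρ / 2 ≤ ‖x‖ := hx.2.2
      rw [hKcrit x h0 (norm_pos_iff.1 (by linarith)) hx.1] at h1
      linarith)
  have hgrad' : ∀ c < 0, ∃ b' > 0, ∀ x, J x ≤ c → ρ ≤ infDist x K → b' ≤ ‖fderiv ℝ J x‖ := by
    intro c hc
    obtain ⟨b', hb', h⟩ := exists_gradient_bound hJ hbdd hPS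
      (F := {x | J x ≤ c} ∩ {x | ρ ≤ infDist x K})
      ((isClosed_le hJ.continuous continuous_const).inter (isClosed_le continuous_const hinfc))
      (fun x hx => le_trans hx.1 hc.le) (fun x hx h0 => by
        have h1 : ρ ≤ infDist x K := hx.2
        have h2 : J x ≤ c := hx.1
        rw [hKcrit x h0 (by rintro rfl; linarith) (h2.trans hc.le)] at h1
        linarith)
    exact ⟨b', hb', fun x h1 h2 => h x ⟨h1, h2⟩⟩
  obtain ⟨L, hL⟩ := hbdd
  have hβ : 0 < b / 4 * ρ := by positivity
  obtain ⟨M, hM⟩ := exists_nat_gt (-L / (b / 4 * ρ))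
  rw [div_lt_iff₀ hβ] at hM
  let ℓ : Fin T.card → X →L[ℝ] ℝ := fun i => T.equivFin.symm i
  have hℓ : ∀ x, infDist x K ≤ 2 * ρ → ∃ i, ℓ i x ≠ 0 := by
    intro x hx
    have h1 := hδT (mem_cthickening_iff.2
      ((ENNReal.le_ofReal_iff_toReal_le (infEDist_ne_top hKne) hδ.le).2 (hx.trans hρδ)))
    obtain ⟨f, hfT, hfx⟩ := Set.mem_iUnion₂.1 h1
    exact ⟨T.equivFin ⟨f, hfT⟩, by simpa [ℓ] using hfx⟩
  obtain ⟨Y, r, hYfin, hYdim, hr, c, hc, hYc⟩ := hJ2 (M * T.card + 1)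
  have hYr : ∀ a : sphere (0 : Y) r, J (a : Y) ≤ c := fun a =>
    hYc _ (a : Y).2 (mem_sphere_zero_iff_norm.1 a.2)
  have : ProperSpace Y := FiniteDimensional.proper ℝ Y
  obtain ⟨f, hfodd, hf⟩ := exists_odd_nonvanishing hJ heven (fun x => hL ⟨x, rfl⟩) hρ hb hc hKρ
    hKneg (fun x h1 h2 h3 => hgrad x ⟨h1, h2, h3⟩) (hgrad' c hc) ℓ hℓ M
    (B := sphere (0 : Y) r) ⟨fun a => -a, continuous_neg⟩ (fun a => neg_neg a)
    ⟨fun a => ((a : Y) : X), by fun_prop⟩ (fun a => rfl) hYr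
    (fun a => (hYr a).trans_lt (by linarith))
  obtain ⟨a, ha⟩ := exists_zero_of_odd_on_normed_sphere hYdim hr
    ⟨fun a p => f a (finProdFinEquiv.symm p).1 (finProdFinEquiv.symm p).2, by fun_prop⟩
    (fun a => by
      have := hfodd a
      ext p
      exact congrFun (congrFun this _) _)
  refine hf a ?_
  ext i k
  have h1 := congrFun ha (finProdFinEquiv (i, k))
  simp only [ContinuousMap.coe_mk, Equiv.symm_apply_apply] at h1
  exact h1

/-- Kajikiya's abstract critical point theorem: on an infinite-dimensional real
Banach space, a C¹ functional `J` that is even, bounded below, vanishes at `0`,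
satisfies the Palais–Smale condition, and admits for every `k` a `k`-dimensional
subspace on which `J` is negative (uniformly) on some sphere of radius `r_k > 0`,
possesses a sequence of nontrivial critical points `v_k` with `J (v_k) ≤ 0` and
`‖v_k‖ → 0`. -/
theorem kajikiya_critical_points
    {X : Type*} [NormedAddCommGroup X] [NormedSpace ℝ X] [CompleteSpace X]
    (hinf : ¬ FiniteDimensional ℝ X)
    (J : X → ℝ) (hJC1 : ContDiff ℝ 1 J)
    (heven : ∀ u : X, J (-u) = J u)
    (hbdd : BddBelow (Set.range J))
    (hJ0 : J 0 = 0)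
    -- Palais–Smale condition: every sequence with `J (u n)` bounded and
    -- `J' (u n) → 0` in the dual space has a convergent subsequence.
    (hPS : ∀ u : ℕ → X,
      (∃ C : ℝ, ∀ n : ℕ, |J (u n)| ≤ C) →
      Filter.Tendsto (fun n => fderiv ℝ J (u n)) Filter.atTop (nhds 0) →
      ∃ φ : ℕ → ℕ, StrictMono φ ∧
        ∃ x : X, Filter.Tendsto (u ∘ φ) Filter.atTop (nhds x))
    -- (J2): for every `k` there are a `k`-dimensional subspace `Xk` and `r > 0`
    -- with `sup { J u : u ∈ Xk, ‖u‖ = r } < 0`.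
    (hJ2 : ∀ k : ℕ, ∃ (Xk : Submodule ℝ X) (r : ℝ),
      FiniteDimensional ℝ Xk ∧ Module.finrank ℝ Xk = k ∧ 0 < r ∧
      ∃ c : ℝ, c < 0 ∧ ∀ u : X, u ∈ Xk → ‖u‖ = r → J u ≤ c) :
    ∃ v : ℕ → X,
      (∀ k : ℕ, fderiv ℝ J (v k) = 0) ∧
      (∀ k : ℕ, v k ≠ 0) ∧
      (∀ k : ℕ, J (v k) ≤ 0) ∧
      Filter.Tendsto (fun k => ‖v k‖) Filter.atTop (nhds 0) := by
  choose v h1 h2 h3 h4 using fun k : ℕ => exists_small_critical_point hinf hJC1 heven hbdd hJ0 hPS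
    hJ2 (ε := 1 / ((k : ℝ) + 1)) (by positivity)
  exact ⟨v, h1, h2, h3, squeeze_zero (fun k => norm_nonneg _) (fun k => (h4 k).le)
    tendsto_one_div_add_atTop_nhds_zero_nat⟩
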